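/- Let f: ℝ → ℝ be real, even and integrable, with Fourier transform f̂ continuous and satisfying |f̂(u)| ≤ A(1+|u|)^{−1−δ} for some A, δ > 0. For each N ≥ 1 define Z_f(U) := Σ_{n∈ℤ} (1/N) f̂(n/N) Tr(U^n) on U(N). Then lim_{N→∞} ∫_{U(N)} (Z_f(U) − f̂(0))² dμ_N(U) = ∫_ℝ min(1, |u|) · f̂(u)² du. -/

import Mathlib

open MeasureTheory Filter

noncomputable instance (N : ℕ) : MeasurableSpace (Matrix.unitaryGroup (Fin N) ℂ) := borel _

/-- The linear statistic `Z_f(U) = ∑_{n ∈ ℤ} (1/N) f̂(n/N) Tr(U^n)` on `U(N)`. -/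
noncomputable def Zf (N : ℕ) (fhat : ℝ → ℝ) (U : Matrix.unitaryGroup (Fin N) ℂ) : ℂ :=
  ∑' n : ℤ, (1 / N : ℂ) * (fhat ((n : ℝ) / N) : ℂ) *
    Matrix.trace ((U ^ n : Matrix.unitaryGroup (Fin N) ℂ) : Matrix (Fin N) (Fin N) ℂ)

/-- The coefficients `h_a` of `exp (∑ c_k t^k / k)`: the complete homogeneous symmetric functions
written in terms of the power sums `c_k`. -/
noncomputable def completeSeq (c : ℕ → ℂ) : ℕ → ℂ
  | 0 => 1
  | a + 1 => (∑ k : Fin (a + 1), c (k + 1) * completeSeq c (a - k)) / (a + 1)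

@[simp] lemma completeSeq_zero (c : ℕ → ℂ) : completeSeq c 0 = 1 := by
  rw [completeSeq]

lemma completeSeq_succ (c : ℕ → ℂ) (a : ℕ) :
    ((a : ℂ) + 1) * completeSeq c (a + 1) =
      ∑ x ∈ Finset.HasAntidiagonal.antidiagonal a, c (x.1 + 1) * completeSeq c x.2 := by
  rw [completeSeq, mul_div_cancel₀ _ (by exact_mod_cast a.succ_ne_zero),
    Finset.Nat.sum_antidiagonal_eq_sum_range_succ (fun i j => c (i + 1) * completeSeq c j),
    Finset.sum_range]

lemma eq_completeSeq {c d : ℕ → ℂ} (h0 : d 0 = 1)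
    (h : ∀ a : ℕ, ((a : ℂ) + 1) * d (a + 1) =
      ∑ x ∈ Finset.HasAntidiagonal.antidiagonal a, c (x.1 + 1) * d x.2) (a : ℕ) :
    d a = completeSeq c a := by
  induction a using Nat.strong_induction_on with
  | _ a ih =>
    cases a with
    | zero => simp [h0]
    | succ a =>
      have ha : (a : ℂ) + 1 ≠ 0 := by exact_mod_cast a.succ_ne_zero
      refine mul_left_cancel₀ ha ?_
      rw [h, completeSeq_succ]
      refine Finset.sum_congr rfl fun x hx => ?_
      rw [ih x.2 (by have := Finset.HasAntidiagonal.mem_antidiagonal.1 hx; omega)]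

open PowerSeries in
lemma derivative_mk_completeSeq (c : ℕ → ℂ) :
    derivative ℂ (mk (completeSeq c)) = mk (fun k => c (k + 1)) * mk (completeSeq c) := by
  ext n
  rw [coeff_derivative, coeff_mul]
  simp only [coeff_mk]
  rw [← completeSeq_succ, mul_comm]

open PowerSeries in
lemma mk_completeSeq_mul_neg (c : ℕ → ℂ) :
    (mk (completeSeq (-c)) * mk (completeSeq c) : PowerSeries ℂ) = 1 := by
  have hd : derivative ℂ (mk (completeSeq (-c)) * mk (completeSeq c)) = 0 := by
    rw [Derivation.leibniz, derivative_mk_completeSeq, derivative_mk_completeSeq]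
    have : (mk fun k => (-c) (k + 1) : PowerSeries ℂ) = - mk fun k => c (k + 1) := by
      ext; simp
    rw [this]; simp only [smul_eq_mul]; ring
  ext n
  cases n with
  | zero => simp
  | succ n =>
    have h := congrArg (coeff n) hd
    rw [coeff_derivative] at h
    have hn : (n : ℂ) + 1 ≠ 0 := by exact_mod_cast n.succ_ne_zero
    simpa [hn, coeff_one] using h

lemma sum_completeSeq_neg_mul (c : ℕ → ℂ) (n : ℕ) :
    ∑ x ∈ Finset.HasAntidiagonal.antidiagonal (n + 1),
      completeSeq (-c) x.1 * completeSeq c x.2 = 0 := by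
  have h := congrArg (PowerSeries.coeff (n + 1)) (mk_completeSeq_mul_neg c)
  rw [PowerSeries.coeff_mul] at h
  simpa [PowerSeries.coeff_one] using h

open PowerSeries in
lemma sum_mul_completeSeq_neg_mul (c : ℕ → ℂ) (n : ℕ) :
    ∑ x ∈ Finset.HasAntidiagonal.antidiagonal n,
        (x.1 : ℂ) * completeSeq (-c) x.1 * completeSeq c x.2 =
      if n = 0 then 0 else - c n := by
  cases n with
  | zero => simp
  | succ n =>
    have h : derivative ℂ (mk (completeSeq (-c))) * mk (completeSeq c) =
        - mk (fun k => c (k + 1)) := by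
      rw [derivative_mk_completeSeq, mul_assoc, mk_completeSeq_mul_neg, mul_one]
      ext; simp
    have h' := congrArg (coeff n) h
    rw [coeff_mul] at h'
    simp only [coeff_derivative, coeff_mk, map_neg] at h'
    rw [Finset.Nat.sum_antidiagonal_succ]
    simp only [Nat.cast_zero, zero_mul, zero_add, Nat.add_eq_zero_iff, one_ne_zero, and_false,
      if_false, ← h']
    refine Finset.sum_congr rfl fun x _ => ?_
    push_cast; ring

/-- The directional derivative of `completeSeq c` when `c k` has derivative `k * τ k`. -/
noncomputable def completeSeqDeriv {M : Type*} [AddCommGroup M] [Module ℂ M] (c : ℕ → ℂ)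
    (τ : ℕ → M) : ℕ → M
  | 0 => 0
  | a + 1 => ∑ x ∈ Finset.HasAntidiagonal.antidiagonal a, completeSeq c x.2 • τ (x.1 + 1)

open PowerSeries in
lemma completeSeqDeriv_rec (c τ : ℕ → ℂ) (a : ℕ) :
    ((a : ℂ) + 1) * completeSeqDeriv c τ (a + 1) =
      ∑ x ∈ Finset.HasAntidiagonal.antidiagonal a,
        (((x.1 : ℂ) + 1) * τ (x.1 + 1) * completeSeq c x.2 +
        c (x.1 + 1) * completeSeqDeriv c τ x.2) := by
  set T : PowerSeries ℂ := mk fun k => τ (k + 1)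
  set H : PowerSeries ℂ := mk (completeSeq c)
  have hD : mk (completeSeqDeriv c τ) = X * (T * H) := by
    ext n
    cases n with
    | zero => simp [completeSeqDeriv]
    | succ n =>
      rw [coeff_succ_X_mul, coeff_mul]
      simp [completeSeqDeriv, T, H, mul_comm]
  have h1 : derivative ℂ (X * (T * H)) =
      derivative ℂ (X * T) * H + mk (fun k => c (k + 1)) * (X * (T * H)) := by
    rw [← mul_assoc, Derivation.leibniz (derivative ℂ) (X * T) H, derivative_mk_completeSeq]
    simp only [smul_eq_mul]; ring
  rw [← hD] at h1
  have h2 := congrArg (coeff a) h1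
  rw [coeff_derivative, map_add, coeff_mul, coeff_mul, ← Finset.sum_add_distrib] at h2
  simp only [coeff_mk, coeff_derivative, coeff_succ_X_mul, T, H] at h2
  rw [mul_comm, h2]
  exact Finset.sum_congr rfl fun x _ => by ring

lemma sum_sum_completeSeq (p : ℕ → ℂ) (a b : ℕ) :
    ∑ x ∈ Finset.HasAntidiagonal.antidiagonal a, ∑ y ∈ Finset.HasAntidiagonal.antidiagonal b,
      completeSeq p x.2 * completeSeq (-p) y.2 * p (x.1 + y.1 + 1) =
    ((a : ℂ) + b + 1) * ∑ j ∈ Finset.range (b + 1),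
      completeSeq (-p) j * completeSeq p (a + b + 1 - j) := by
  induction b generalizing a with
  | zero =>
    simp only [Finset.Nat.antidiagonal_zero, Finset.sum_singleton, completeSeq_zero, mul_one,
      add_zero, zero_add, Finset.sum_range_one, one_mul, Nat.cast_zero, Nat.sub_zero]
    rw [completeSeq_succ]
    exact Finset.sum_congr rfl fun x _ => by ring
  | succ b ih =>
    have h1 := ih (a + 1)
    rw [Finset.Nat.sum_antidiagonal_succ] at h1
    simp only [Finset.Nat.sum_antidiagonal_succ (n := b), Finset.sum_add_distrib]
    rw [Finset.sum_range_succ]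
    have h2 : ∑ x ∈ Finset.HasAntidiagonal.antidiagonal a,
        completeSeq p x.2 * completeSeq (-p) (b + 1) * p (x.1 + 0 + 1) =
        completeSeq (-p) (b + 1) * (((a : ℂ) + 1) * completeSeq p (a + 1)) := by
      rw [completeSeq_succ, Finset.mul_sum]
      exact Finset.sum_congr rfl fun x _ => by rw [add_zero]; ring
    have h3 : ∑ y ∈ Finset.HasAntidiagonal.antidiagonal b,
        completeSeq p (a + 1) * completeSeq (-p) y.2 * p (0 + y.1 + 1) =
        - completeSeq p (a + 1) * (((b : ℂ) + 1) * completeSeq (-p) (b + 1)) := by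
      rw [completeSeq_succ, Finset.mul_sum]
      exact Finset.sum_congr rfl fun x _ => by rw [zero_add, Pi.neg_apply]; ring
    have h4 : ∀ x y : ℕ × ℕ, x.1 + 1 + y.1 + 1 = x.1 + (y.1 + 1) + 1 := fun _ _ => by omega
    have e1 : a + 1 + b + 1 = a + (b + 1) + 1 := by omega
    have e2 : a + (b + 1) + 1 - (b + 1) = a + 1 := by omega
    simp only [h4, e1] at h1
    rw [h2, e2]
    rw [h3] at h1
    push_cast at h1 ⊢
    linear_combination h1

lemma sum_antidiagonal_assoc {M : Type*} [AddCommMonoid M] (f : ℕ → ℕ → ℕ → M) (n : ℕ) :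
    ∑ x ∈ Finset.HasAntidiagonal.antidiagonal n, ∑ y ∈ Finset.HasAntidiagonal.antidiagonal x.2,
      f x.1 y.1 y.2 =
    ∑ x ∈ Finset.HasAntidiagonal.antidiagonal n, ∑ y ∈ Finset.HasAntidiagonal.antidiagonal x.1,
      f y.1 y.2 x.2 := by
  rw [Finset.sum_sigma', Finset.sum_sigma']
  refine Finset.sum_nbij' (fun z => ⟨(z.1.1 + z.2.1, z.2.2), (z.1.1, z.2.1)⟩)
    (fun z => ⟨(z.2.1, z.2.2 + z.1.2), (z.2.2, z.1.2)⟩) ?_ ?_ ?_ ?_ ?_ <;>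
  · rintro ⟨⟨a, b⟩, ⟨c, d⟩⟩ h
    simp only [Finset.mem_sigma, Finset.HasAntidiagonal.mem_antidiagonal] at h ⊢
    try obtain ⟨rfl, rfl⟩ := h
    try simp [add_assoc]

lemma sum_completeSeqDeriv_shift (p : ℕ → ℂ) (a : ℕ) :
    ∑ x ∈ Finset.HasAntidiagonal.antidiagonal a, completeSeqDeriv p (fun m => p (x.1 + m)) x.2 =
    ∑ x ∈ Finset.HasAntidiagonal.antidiagonal a, (x.1 : ℂ) * p x.1 * completeSeq p x.2 := by
  cases a with
  | zero => simp [completeSeqDeriv]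
  | succ a =>
    rw [Finset.Nat.sum_antidiagonal_succ', Finset.Nat.sum_antidiagonal_succ]
    simp only [completeSeqDeriv, smul_eq_mul, Nat.cast_zero, zero_mul, zero_add]
    rw [sum_antidiagonal_assoc fun i j l => completeSeq p l * p (i + (j + 1))]
    refine Finset.sum_congr rfl fun x _ => ?_
    rw [Finset.sum_congr rfl fun y hy => by
      rw [← add_assoc, Finset.HasAntidiagonal.mem_antidiagonal.1 hy]]
    simp only [Finset.sum_const, Finset.Nat.card_antidiagonal, nsmul_eq_mul]
    push_cast; ring

open PowerSeries in
/-- The trace identity behind the second-order loop equation for `completeSeq`. -/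
lemma sum_completeSeq_loop (p : ℕ → ℂ) (a : ℕ) :
    ∑ x ∈ Finset.HasAntidiagonal.antidiagonal a,
      ((∑ j ∈ Finset.range x.1, p j * p (x.1 - j)) * completeSeq p x.2 +
      completeSeqDeriv p (fun m => p (x.1 + m)) x.2) =
    (a : ℂ) * (a + p 0) * completeSeq p a := by
  set P : PowerSeries ℂ := mk fun k => p (k + 1)
  set H : PowerSeries ℂ := mk (completeSeq p)
  have hH : derivative ℂ H = P * H := derivative_mk_completeSeq p
  have h1 : (mk fun k => ∑ j ∈ Finset.range k, p j * p (k - j) : PowerSeries ℂ) =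
      mk p * (X * P) := by
    ext n
    cases n with
    | zero => simp
    | succ n =>
      rw [show mk p * (X * P) = X * (mk p * P) by ring, coeff_succ_X_mul, coeff_mul, coeff_mk]
      simp only [coeff_mk, P]
      rw [Finset.Nat.sum_antidiagonal_eq_sum_range_succ (fun i j => p i * p (j + 1))]
      refine Finset.sum_congr rfl fun j hj => ?_
      rw [Nat.succ_sub (by have := Finset.mem_range.1 hj; omega)]
  have h2 : (mk fun k => (k : ℂ) * p k : PowerSeries ℂ) = X * derivative ℂ (X * P) := by
    ext n
    cases n with
    | zero => simp
    | succ n =>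
      rw [coeff_succ_X_mul, coeff_derivative, coeff_succ_X_mul]
      simp [P, mul_comm]
  have h0 : (mk p : PowerSeries ℂ) = C (p 0) + X * P := by
    ext n
    cases n with
    | zero => simp
    | succ n => simp [P, coeff_succ_X_mul]
  have h3 : (mk fun k => (k : ℂ) * (k + p 0) * completeSeq p k : PowerSeries ℂ) =
      X * derivative ℂ (X * derivative ℂ H) + C (p 0) * (X * derivative ℂ H) := by
    ext n
    cases n with
    | zero => simp
    | succ n =>
      simp only [map_add, coeff_succ_X_mul, coeff_derivative, coeff_C_mul, coeff_mk, H]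
      push_cast; ring
  have key : (mk fun k => ∑ j ∈ Finset.range k, p j * p (k - j) : PowerSeries ℂ) * H +
      (mk fun k => (k : ℂ) * p k : PowerSeries ℂ) * H =
      mk fun k => (k : ℂ) * (k + p 0) * completeSeq p k := by
    rw [h1, h2, h3, h0, hH, show X * (P * H) = (X * P) * H by ring,
      Derivation.leibniz (derivative ℂ) (X * P) H, hH]
    simp only [smul_eq_mul]; ring
  have h := congrArg (coeff a) key
  rw [map_add, coeff_mul, coeff_mul] at h
  simp only [coeff_mk, H] at h
  rw [Finset.sum_add_distrib, sum_completeSeqDeriv_shift, h]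

lemma Matrix.aeval_charpolyRev {n A : Type*} [Fintype n] [DecidableEq n] [CommRing A] [Algebra ℂ A]
    (U : Matrix n n ℂ) (x : A) :
    Polynomial.aeval x U.charpolyRev = (1 - x • U.map (algebraMap ℂ A)).det := by
  rw [Matrix.charpolyRev, AlgHom.map_det]
  congr 1
  ext i j
  by_cases h : i = j <;> simpa [h] using mul_comm _ _

open PowerSeries in
lemma Matrix.one_sub_X_smul_mul_geom {n : Type*} [Fintype n] [DecidableEq n] (U : Matrix n n ℂ) :
    (1 - (X : PowerSeries ℂ) • U.map (algebraMap ℂ (PowerSeries ℂ))) *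
      (Matrix.of fun i j => mk fun k => (U ^ k) i j) = 1 := by
  ext i j m
  rw [sub_mul, one_mul, smul_mul_assoc, Matrix.sub_apply, Matrix.smul_apply, smul_eq_mul, map_sub,
    Matrix.of_apply, coeff_mk]
  cases m with
  | zero => simp [Matrix.one_apply, apply_ite]
  | succ m =>
    rw [coeff_succ_X_mul, Matrix.mul_apply, map_sum, pow_succ', Matrix.mul_apply]
    simp [Matrix.one_apply, apply_ite, coeff_one]

open PowerSeries in
lemma Matrix.derivative_charpolyRev {n : Type*} [Fintype n] [DecidableEq n] (U : Matrix n n ℂ) :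
    ((Polynomial.derivative U.charpolyRev : Polynomial ℂ) : PowerSeries ℂ) =
      - (mk fun k => (U ^ (k + 1)).trace) * (U.charpolyRev : PowerSeries ℂ) := by
  set W : Matrix n n (PowerSeries ℂ) := Matrix.of fun i j => mk fun k => (U ^ k) i j with hW
  let S := DualNumber (PowerSeries ℂ)
  let ι : PowerSeries ℂ →+* S := algebraMap _ _
  let x : S := ι X
  have hx : ∀ p : Polynomial ℂ, Polynomial.aeval x p = ι (p : PowerSeries ℂ) := by
    intro p
    rw [Polynomial.aeval_algebraMap_apply, ← Polynomial.eval₂_C_X_eq_coe]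
    rfl
  have hι : U.map (algebraMap ℂ S) = (U.map (algebraMap ℂ (PowerSeries ℂ))).map ι := by
    rw [Matrix.map_map, ← RingHom.coe_comp, ← IsScalarTower.algebraMap_eq]
  have he : (DualNumber.eps : S) ^ 2 = 0 := by rw [pow_two]; exact DualNumber.eps_mul_eps
  have h1 := Polynomial.aeval_add_of_sq_eq_zero U.charpolyRev x (DualNumber.eps : S) he
  have hWS : (1 - x • U.map (algebraMap ℂ S)) * W.map ι = 1 := by
    have h := congrArg ι.mapMatrix (Matrix.one_sub_X_smul_mul_geom U)
    rw [map_mul, map_sub, map_one] at h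
    rw [hι, ← h]
    congr 2
    ext i j : 1
    simp [x]
  have h2 : (1 - (x + DualNumber.eps) • U.map (algebraMap ℂ S)) =
      (1 - x • U.map (algebraMap ℂ S)) *
        (1 + (DualNumber.eps : S) • (-(W.map ι * U.map (algebraMap ℂ S)))) := by
    rw [mul_add, mul_one, mul_smul_comm, mul_neg, ← mul_assoc, hWS, one_mul, add_smul, smul_neg]
    abel
  rw [Matrix.aeval_charpolyRev, h2, Matrix.det_mul, ← Matrix.aeval_charpolyRev,
    Matrix.det_one_add_smul, he, mul_zero, add_zero, hx, hx] at h1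
  have h3 : (W.map ι * U.map (algebraMap ℂ S)).trace = ι (mk fun k => (U ^ (k + 1)).trace) := by
    rw [hι, ← Matrix.map_mul, ← AddMonoidHom.map_trace]
    congr 1
    ext m
    simp [Matrix.trace, Matrix.mul_apply, hW, pow_succ]
  rw [Matrix.trace_neg, h3] at h1
  have hinl : ∀ y, ι y = TrivSqZeroExt.inl y := fun _ => rfl
  have h4 := congrArg TrivSqZeroExt.snd h1
  simp only [hinl, DualNumber.eps, S] at h4
  simpa [mul_comm] using h4.symm

lemma completeSeq_neg_trace_pow_eq_zero {n : Type*} [Fintype n] [DecidableEq n] (U : Matrix n n ℂ)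
    {b : ℕ} (hb : Fintype.card n < b) :
    completeSeq (-fun k => (U ^ k).trace) b = 0 := by
  rw [← eq_completeSeq (d := U.charpolyRev.coeff)]
  · apply Polynomial.coeff_eq_zero_of_natDegree_lt
    rw [← Matrix.reverse_charpoly]
    exact (Polynomial.reverse_natDegree_le _).trans_lt
      (by rwa [Matrix.charpoly_natDegree_eq_dim])
  · rw [Polynomial.coeff_zero_eq_eval_zero, Matrix.eval_charpolyRev]
  · intro a
    have := congrArg (PowerSeries.coeff a) (Matrix.derivative_charpolyRev U)
    rw [PowerSeries.coeff_mul] at this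
    simp only [Polynomial.coeff_coe, Polynomial.coeff_derivative, map_neg,
      PowerSeries.coeff_mk] at this
    rw [mul_comm, this]
    rfl

section UnitaryCalculus

open Matrix

variable {N : ℕ}

instance : BorelSpace (unitaryGroup (Fin N) ℂ) := ⟨rfl⟩

instance : CompactSpace (unitaryGroup (Fin N) ℂ) := by
  have hK : IsCompact (Set.univ.pi fun _ : Fin N => Set.univ.pi fun _ : Fin N =>
      Metric.closedBall (0 : ℂ) 1) :=
    isCompact_univ_pi fun _ => isCompact_univ_pi fun _ => isCompact_closedBall _ _
  have h : IsCompact (X := Matrix (Fin N) (Fin N) ℂ) {A | A * star A = 1} := by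
    refine IsCompact.of_isClosed_subset (X := Matrix (Fin N) (Fin N) ℂ) hK ?_ ?_
    · exact isClosed_eq (by fun_prop) continuous_const
    · intro U hU i _ j _
      simpa using entry_norm_bound_of_unitary (mem_unitaryGroup_iff.2 hU) i j
  have e : {A : Matrix (Fin N) (Fin N) ℂ | A * star A = 1} =
      {A | A ∈ unitaryGroup (Fin N) ℂ} := by
    ext A; simp [mem_unitaryGroup_iff]
  rw [e] at h
  exact isCompact_iff_compactSpace.1 h

lemma integrable_of_continuous_unitaryGroup (μ : Measure (unitaryGroup (Fin N) ℂ))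
    [IsFiniteMeasure μ] {F : unitaryGroup (Fin N) ℂ → ℂ} (hF : Continuous F) : Integrable F μ := by
  obtain ⟨C, hC⟩ := isCompact_univ.exists_bound_of_continuousOn hF.continuousOn
  exact Integrable.of_bound hF.aestronglyMeasurable C (.of_forall fun U => hC U (Set.mem_univ U))

/-- The one-parameter group `τ ↦ exp (τ X)` in the unitary group. -/
noncomputable def expUnitary (X : skewAdjoint (Matrix (Fin N) (Fin N) ℂ)) (τ : ℝ) :
    unitaryGroup (Fin N) ℂ :=
  ⟨NormedSpace.exp (τ • X.1), by
    have hX : star X.1 = -X.1 := skewAdjoint.mem_iff.1 X.2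
    rw [mem_unitaryGroup_iff, star_eq_conjTranspose, ← Matrix.exp_conjTranspose,
      conjTranspose_smul, ← star_eq_conjTranspose, hX, star_trivial,
      ← Matrix.exp_add_of_commute _ _ (((Commute.refl X.1).neg_right.smul_left τ).smul_right τ)]
    simp⟩

lemma expUnitary_zero (X : skewAdjoint (Matrix (Fin N) (Fin N) ℂ)) : expUnitary X 0 = 1 := by
  ext1
  simp [expUnitary]

lemma expUnitary_add (X : skewAdjoint (Matrix (Fin N) (Fin N) ℂ)) (s t : ℝ) :
    expUnitary X (s + t) = expUnitary X s * expUnitary X t := by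
  apply Subtype.ext
  simp only [expUnitary, add_smul, Submonoid.coe_mul]
  exact Matrix.exp_add_of_commute _ _ (((Commute.refl X.1).smul_left s).smul_right t)

open NormedSpace in
lemma hasDerivAt_exp_smul_mul_pow {𝔸 : Type*} [NormedRing 𝔸] [NormedAlgebra ℝ 𝔸]
    [CompleteSpace 𝔸] (X U : 𝔸) (k : ℕ) :
    HasDerivAt (fun τ : ℝ => (exp (τ • X) * U) ^ k)
      (∑ m ∈ Finset.range k, U ^ m * X * U ^ (k - m)) 0 := by
  have h0 : HasDerivAt (fun τ : ℝ => exp (τ • X) * U) (X * U) 0 := by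
    simpa using (hasDerivAt_exp_smul_const (𝕂 := ℝ) X 0).mul_const U
  induction k with
  | zero => simpa using hasDerivAt_const (0 : ℝ) (1 : 𝔸)
  | succ k ih =>
    have h := ih.mul h0
    simp only [zero_smul, exp_zero, one_mul] at h
    simp only [pow_succ _ k]
    refine h.congr_deriv ?_
    rw [Finset.sum_range_succ, Finset.sum_mul]
    congr 1
    · refine Finset.sum_congr rfl fun m hm => ?_
      rw [Nat.succ_sub (Finset.mem_range.1 hm).le, pow_succ, mul_assoc (U ^ m * X)]
    · simp [mul_assoc]

/-- `G` is the left-invariant gradient of `F`: the derivative of `F` along `τ ↦ exp (τ X) U`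
is `Tr (X G(U))`. -/
def HasUnitaryGrad (F : unitaryGroup (Fin N) ℂ → ℂ)
    (G : unitaryGroup (Fin N) ℂ → Matrix (Fin N) (Fin N) ℂ) : Prop :=
  ∀ (X : skewAdjoint (Matrix (Fin N) (Fin N) ℂ)) (U : unitaryGroup (Fin N) ℂ),
    HasDerivAt (fun τ : ℝ => F (expUnitary X τ * U)) (trace (X.1 * G U)) 0

variable {F F' : unitaryGroup (Fin N) ℂ → ℂ}
  {G G' : unitaryGroup (Fin N) ℂ → Matrix (Fin N) (Fin N) ℂ}

lemma HasUnitaryGrad.mul (h : HasUnitaryGrad F G) (h' : HasUnitaryGrad F' G') :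
    HasUnitaryGrad (fun U => F U * F' U) (fun U => F' U • G U + F U • G' U) := by
  intro X U
  refine ((h X U).mul (h' X U)).congr_deriv ?_
  simp [expUnitary_zero, mul_add]
  ring

lemma HasUnitaryGrad.star_comp (h : HasUnitaryGrad F G) :
    HasUnitaryGrad (fun U => star (F U)) (fun U => - star (G U)) := by
  intro X U
  refine (h X U).star.congr_deriv ?_
  have hX : star X.1 = -X.1 := skewAdjoint.mem_iff.1 X.2
  rw [← Matrix.trace_conjTranspose, Matrix.conjTranspose_mul, ← star_eq_conjTranspose,
    ← star_eq_conjTranspose, hX, Matrix.trace_mul_comm]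
  simp

lemma hasUnitaryGrad_trace_pow_mul (k : ℕ) (Y : Matrix (Fin N) (Fin N) ℂ) :
    HasUnitaryGrad (fun U => trace ((U : Matrix (Fin N) (Fin N) ℂ) ^ k * Y))
      (fun U => ∑ m ∈ Finset.range k, (U : Matrix (Fin N) (Fin N) ℂ) ^ (k - m) * Y *
        (U : Matrix (Fin N) (Fin N) ℂ) ^ m) := by
  intro X U
  let _ : NormedRing (Matrix (Fin N) (Fin N) ℂ) := Matrix.linftyOpNormedRing
  let _ : NormedAlgebra ℝ (Matrix (Fin N) (Fin N) ℂ) := Matrix.linftyOpNormedAlgebra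
  let L : Matrix (Fin N) (Fin N) ℂ →L[ℝ] ℂ := LinearMap.toContinuousLinearMap
    ((Matrix.traceLinearMap (Fin N) ℝ ℂ).comp (LinearMap.mulRight ℝ Y))
  have h := (L.hasFDerivAt (x := (NormedSpace.exp ((0 : ℝ) • X.1) * U.1) ^ k)).comp_hasDerivAt
    (0 : ℝ) (hasDerivAt_exp_smul_mul_pow X.1 U.1 k)
  refine HasDerivAt.congr_deriv (f' := L (∑ m ∈ Finset.range k, U.1 ^ m * X.1 * U.1 ^ (k - m)))
    h ?_
  simp only [L, LinearMap.coe_toContinuousLinearMap', LinearMap.comp_apply,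
    LinearMap.mulRight_apply, traceLinearMap_apply, Finset.sum_mul, Finset.mul_sum, trace_sum]
  refine Finset.sum_congr rfl fun m _ => ?_
  rw [mul_assoc, mul_assoc, Matrix.trace_mul_comm, mul_assoc, mul_assoc]

lemma hasUnitaryGrad_trace_pow (k : ℕ) :
    HasUnitaryGrad (fun U : unitaryGroup (Fin N) ℂ => trace ((U : Matrix (Fin N) (Fin N) ℂ) ^ k))
      (fun U => (k : ℂ) • (U : Matrix (Fin N) (Fin N) ℂ) ^ k) := by
  have h := hasUnitaryGrad_trace_pow_mul (N := N) k 1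
  simp only [mul_one] at h
  convert h using 2 with U
  rw [Finset.sum_congr rfl fun m hm => by
    rw [← pow_add, Nat.sub_add_cancel (Finset.mem_range.1 hm).le]]
  simp [← Nat.cast_smul_eq_nsmul ℂ]

lemma hasUnitaryGrad_trace_pow_apply (k : ℕ) (i j : Fin N) :
    HasUnitaryGrad (fun U : unitaryGroup (Fin N) ℂ => ((U : Matrix (Fin N) (Fin N) ℂ) ^ k) i j)
      (fun U => ∑ m ∈ Finset.range k, (U : Matrix (Fin N) (Fin N) ℂ) ^ (k - m) *
        Matrix.single j i 1 * (U : Matrix (Fin N) (Fin N) ℂ) ^ m) := by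
  simpa [Matrix.trace_mul_single] using hasUnitaryGrad_trace_pow_mul k (Matrix.single j i (1 : ℂ))

lemma hasDerivAt_completeSeq {c : ℕ → ℝ → ℂ} {τ : ℕ → ℂ} {t : ℝ}
    (hc : ∀ k, HasDerivAt (c k) (k * τ k) t) (a : ℕ) :
    HasDerivAt (fun s => completeSeq (fun k => c k s) a)
      (completeSeqDeriv (fun k => c k t) τ a) t := by
  induction a using Nat.strong_induction_on with
  | _ a ih =>
    cases a with
    | zero => simpa [completeSeqDeriv] using hasDerivAt_const t (1 : ℂ)
    | succ a =>
      have ha : (a : ℂ) + 1 ≠ 0 := by exact_mod_cast a.succ_ne_zero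
      have h : HasDerivAt (fun s => ((a : ℂ) + 1)⁻¹ *
          ∑ x ∈ Finset.HasAntidiagonal.antidiagonal a, c (x.1 + 1) s *
            completeSeq (fun k => c k s) x.2)
          (((a : ℂ) + 1)⁻¹ * ∑ x ∈ Finset.HasAntidiagonal.antidiagonal a,
            (((x.1 + 1 : ℕ) : ℂ) * τ (x.1 + 1) * completeSeq (fun k => c k t) x.2 +
              c (x.1 + 1) t * completeSeqDeriv (fun k => c k t) τ x.2)) t := by
        refine HasDerivAt.const_mul _ (HasDerivAt.fun_sum fun x hx => ?_)
        exact (hc _).mul (ih x.2 (by have := Finset.HasAntidiagonal.mem_antidiagonal.1 hx; omega))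
      have e := completeSeqDeriv_rec (fun k => c k t) τ a
      push_cast at h
      rw [← e, inv_mul_cancel_left₀ ha] at h
      refine h.congr_of_eventuallyEq (.of_forall fun s => ?_)
      simp only
      rw [← completeSeq_succ (fun k => c k s), inv_mul_cancel_left₀ ha]

lemma hasUnitaryGrad_completeSeq {c : unitaryGroup (Fin N) ℂ → ℕ → ℂ}
    {T : unitaryGroup (Fin N) ℂ → ℕ → Matrix (Fin N) (Fin N) ℂ}
    (hc : ∀ k, HasUnitaryGrad (fun U => c U k) (fun U => (k : ℂ) • T U k)) (a : ℕ) :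
    HasUnitaryGrad (fun U => completeSeq (c U) a) (fun U => completeSeqDeriv (c U) (T U) a) := by
  intro X U
  have h := hasDerivAt_completeSeq (c := fun k τ => c (expUnitary X τ * U) k)
    (τ := fun k => trace (X.1 * T U k)) (t := 0) (fun k => by simpa using hc k X U) a
  refine h.congr_deriv ?_
  simp only [expUnitary_zero, one_mul]
  cases a with
  | zero => simp [completeSeqDeriv]
  | succ a => simp [completeSeqDeriv, Finset.mul_sum, Matrix.trace_sum]

lemma HasUnitaryGrad.integral_trace_eq_zero (μ : Measure (unitaryGroup (Fin N) ℂ))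
    [IsProbabilityMeasure μ] [μ.IsMulLeftInvariant] (h : HasUnitaryGrad F G) (hF : Continuous F)
    (hG : Continuous G) (X : skewAdjoint (Matrix (Fin N) (Fin N) ℂ)) :
    ∫ U, trace (X.1 * G U) ∂μ = 0 := by
  have hcont : Continuous fun U => trace (X.1 * G U) := by fun_prop
  have hderiv : ∀ (U : unitaryGroup (Fin N) ℂ) (s : ℝ), HasDerivAt
      (fun τ : ℝ => F (expUnitary X τ * U)) (trace (X.1 * G (expUnitary X s * U))) s := by
    intro U s
    have := h X (expUnitary X s * U)
    rw [← sub_self s] at this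
    have := this.comp_sub_const s s
    refine this.congr_of_eventuallyEq (.of_forall fun τ => ?_)
    simp only
    rw [← mul_assoc, ← expUnitary_add, sub_add_cancel]
  obtain ⟨C, hC⟩ := isCompact_univ.exists_bound_of_continuousOn hcont.continuousOn
  have key := (hasDerivAt_integral_of_dominated_loc_of_deriv_le (μ := μ) (x₀ := (0 : ℝ))
    (F := fun τ U => F (expUnitary X τ * U))
    (F' := fun τ U => trace (X.1 * G (expUnitary X τ * U))) (bound := fun _ => C)
    (s := Set.univ) Filter.univ_mem
    (.of_forall fun τ => by
      exact (hF.comp (continuous_const_mul _)).aestronglyMeasurable)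
    (integrable_of_continuous_unitaryGroup μ (hF.comp (continuous_const_mul _)))
    (hcont.comp (continuous_const_mul _)).aestronglyMeasurable
    (.of_forall fun U τ _ => hC _ (Set.mem_univ _)) (integrable_const _)
    (.of_forall fun U τ _ => hderiv U τ)).2
  have hconst : (fun τ : ℝ => ∫ U, F (expUnitary X τ * U) ∂μ) = fun _ => ∫ U, F U ∂μ := by
    ext τ
    exact integral_mul_left_eq_self F _
  rw [hconst] at key
  simpa [expUnitary_zero] using key.unique (hasDerivAt_const _ _)

lemma HasUnitaryGrad.integral_apply_eq_zero (μ : Measure (unitaryGroup (Fin N) ℂ))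
    [IsProbabilityMeasure μ] [μ.IsMulLeftInvariant] (h : HasUnitaryGrad F G) (hF : Continuous F)
    (hG : Continuous G) (i j : Fin N) : ∫ U, G U i j ∂μ = 0 := by
  have hint : ∀ i j, Integrable (fun U => G U i j) μ := fun i j =>
    integrable_of_continuous_unitaryGroup μ (by fun_prop)
  have h1 := h.integral_trace_eq_zero μ hF hG ⟨Matrix.single i j 1 - Matrix.single j i 1, by
    rw [skewAdjoint.mem_iff]; simp [star_eq_conjTranspose]⟩
  have h2 := h.integral_trace_eq_zero μ hF hG
    ⟨Complex.I • (Matrix.single i j 1 + Matrix.single j i 1), by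
    rw [skewAdjoint.mem_iff]; simp [star_eq_conjTranspose, add_comm, ← single_neg]⟩
  simp only [sub_mul, add_mul, smul_mul_assoc, trace_sub, trace_add, trace_smul,
    Matrix.trace_single_mul, one_mul, smul_eq_mul, integral_const_mul] at h1 h2
  rw [integral_sub (hint _ _) (hint _ _)] at h1
  rw [integral_add (hint _ _) (hint _ _)] at h2
  have h3 := (mul_eq_zero.1 h2).resolve_left Complex.I_ne_zero
  linear_combination (h3 - h1) / 2

end UnitaryCalculus

section LoopEquation

open Matrix

variable {N : ℕ}

/-- The power sums `Tr (U ^ k)`. -/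
noncomputable def powerSum (U : unitaryGroup (Fin N) ℂ) (k : ℕ) : ℂ :=
  trace ((U : Matrix (Fin N) (Fin N) ℂ) ^ k)

@[simp] lemma powerSum_zero (U : unitaryGroup (Fin N) ℂ) : powerSum U 0 = N := by
  simp [powerSum]

@[fun_prop]
lemma continuous_powerSum (k : ℕ) :
    Continuous fun U : unitaryGroup (Fin N) ℂ => powerSum U k := by
  unfold powerSum; fun_prop

lemma continuous_completeSeq {α : Type*} [TopologicalSpace α] {c : α → ℕ → ℂ}
    (hc : ∀ k, Continuous fun x => c x k) (a : ℕ) : Continuous fun x => completeSeq (c x) a := by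
  induction a using Nat.strong_induction_on with
  | _ a ih =>
    cases a with
    | zero => simpa using continuous_const
    | succ a =>
      simp only [completeSeq]
      refine Continuous.div_const (continuous_finsetSum _ fun k _ => ?_) _
      exact (hc _).mul (ih _ (by omega))

lemma continuous_completeSeqDeriv {α M : Type*} [TopologicalSpace α] [AddCommGroup M]
    [Module ℂ M] [TopologicalSpace M] [ContinuousAdd M] [ContinuousSMul ℂ M]
    {c : α → ℕ → ℂ} {τ : α → ℕ → M}
    (hc : ∀ k, Continuous fun x => c x k) (hτ : ∀ k, Continuous fun x => τ x k) (a : ℕ) :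
    Continuous fun x => completeSeqDeriv (c x) (τ x) a := by
  cases a with
  | zero => simpa [completeSeqDeriv] using continuous_const
  | succ a =>
    simp only [completeSeqDeriv]
    exact continuous_finsetSum _ fun x _ => (continuous_completeSeq hc _).smul (hτ _)

@[fun_prop]
lemma continuous_completeSeq_powerSum (a : ℕ) :
    Continuous fun U : unitaryGroup (Fin N) ℂ => completeSeq (powerSum U) a :=
  continuous_completeSeq continuous_powerSum a

@[fun_prop]
lemma continuous_completeSeq_neg_powerSum (a : ℕ) :
    Continuous fun U : unitaryGroup (Fin N) ℂ => completeSeq (-powerSum U) a :=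
  continuous_completeSeq (fun k => (continuous_powerSum k).neg) a

lemma trace_mul_completeSeqDeriv (A : Matrix (Fin N) (Fin N) ℂ) (c : ℕ → ℂ)
    (τ : ℕ → Matrix (Fin N) (Fin N) ℂ) (i : ℕ) :
    trace (A * completeSeqDeriv c τ i) = completeSeqDeriv c (fun m => trace (A * τ m)) i := by
  cases i with
  | zero => simp [completeSeqDeriv]
  | succ i => simp [completeSeqDeriv, Finset.mul_sum, trace_sum]

lemma trace_pow_mul_star_pow (U : unitaryGroup (Fin N) ℂ) {k n : ℕ} (hk : k ≤ n) :
    trace ((U : Matrix (Fin N) (Fin N) ℂ) ^ k * star ((U : Matrix (Fin N) (Fin N) ℂ) ^ n)) =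
      star (powerSum U (n - k)) := by
  have hU : ((U ^ k : unitaryGroup (Fin N) ℂ) : Matrix (Fin N) (Fin N) ℂ) *
      star ((U ^ k : unitaryGroup (Fin N) ℂ) : Matrix (Fin N) (Fin N) ℂ) = 1 :=
    mem_unitaryGroup_iff.1 (U ^ k).2
  obtain ⟨d, rfl⟩ := Nat.exists_eq_add_of_le hk
  rw [add_comm k d, pow_add, star_mul, ← mul_assoc]
  rw [SubmonoidClass.coe_pow] at hU
  rw [hU, one_mul, star_eq_conjTranspose, trace_conjTranspose, Nat.add_sub_cancel, powerSum]

lemma sum_sum_loop (A B : Matrix (Fin N) (Fin N) ℂ) (c : ℂ) (k : ℕ) :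
    ∑ i, ∑ j, (c • (∑ m ∈ Finset.range k, A ^ (k - m) * Matrix.single j i 1 * A ^ m) +
      (A ^ k) i j • B) j i =
    (∑ m ∈ Finset.range k, trace (A ^ m) * trace (A ^ (k - m))) * c + trace (A ^ k * B) := by
  have hs : ∀ (A B : Matrix (Fin N) (Fin N) ℂ) (i j : Fin N),
      (A * Matrix.single j i (1 : ℂ) * B : Matrix (Fin N) (Fin N) ℂ) j i = B i i * A j j := by
    intro A B i j
    rw [Matrix.mul_apply, Finset.sum_eq_single i (fun l _ hl => by simp [hl]) (by simp)]
    simp [mul_comm]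
  simp only [Matrix.add_apply, Matrix.smul_apply, smul_eq_mul, Finset.sum_add_distrib,
    Matrix.sum_apply, hs, ← Finset.mul_sum]
  congr 1
  rw [mul_comm]
  congr 1
  simp_rw [Finset.sum_comm (s := Finset.univ) (t := Finset.range k), ← Finset.mul_sum,
    ← Finset.sum_mul]
  rfl

lemma HasUnitaryGrad.integral_loop (μ : Measure (unitaryGroup (Fin N) ℂ))
    [IsProbabilityMeasure μ] [μ.IsMulLeftInvariant] {F : unitaryGroup (Fin N) ℂ → ℂ}
    {G : unitaryGroup (Fin N) ℂ → Matrix (Fin N) (Fin N) ℂ} (h : HasUnitaryGrad F G)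
    (hF : Continuous F) (hG : Continuous G) (k : ℕ) :
    ∫ U, ((∑ m ∈ Finset.range k, powerSum U m * powerSum U (k - m)) * F U +
      trace ((U : Matrix (Fin N) (Fin N) ℂ) ^ k * G U)) ∂μ = 0 := by
  let g : Fin N → Fin N → unitaryGroup (Fin N) ℂ → ℂ := fun i j U =>
    (F U • (∑ m ∈ Finset.range k, (U : Matrix (Fin N) (Fin N) ℂ) ^ (k - m) *
      Matrix.single j i 1 * (U : Matrix (Fin N) (Fin N) ℂ) ^ m) +
      ((U : Matrix (Fin N) (Fin N) ℂ) ^ k : Matrix (Fin N) (Fin N) ℂ) i j • G U) j i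
  have hg : ∀ i j, Continuous (g i j) := fun i j => by
    have : Continuous fun U => (F U • (∑ m ∈ Finset.range k,
      (U : Matrix (Fin N) (Fin N) ℂ) ^ (k - m) *
      Matrix.single j i 1 * (U : Matrix (Fin N) (Fin N) ℂ) ^ m) +
      ((U : Matrix (Fin N) (Fin N) ℂ) ^ k : Matrix (Fin N) (Fin N) ℂ) i j • G U) := by fun_prop
    exact this.matrix_elem j i
  have key : ∀ i j, ∫ U, g i j U ∂μ = 0 := fun i j =>
    ((hasUnitaryGrad_trace_pow_apply k i j).mul h).integral_apply_eq_zero μ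
      (by fun_prop) (by fun_prop) j i
  have hsum : ∫ U, ∑ i, ∑ j, g i j U ∂μ = 0 := by
    rw [integral_finsetSum _ fun i _ => integrable_of_continuous_unitaryGroup μ
      (continuous_finsetSum _ fun j _ => hg i j)]
    refine Finset.sum_eq_zero fun i _ => ?_
    rw [integral_finsetSum _ fun j _ => integrable_of_continuous_unitaryGroup μ (hg i j)]
    exact Finset.sum_eq_zero fun j _ => key i j
  rw [← hsum]
  refine integral_congr_ae (.of_forall fun U => ?_)
  exact (sum_sum_loop (U : Matrix (Fin N) (Fin N) ℂ) (G U) (F U) k).symm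

/-- The moments `E[ẽ_b h_a star (p_n)]`, where `ẽ_b = (-1)^b e_b`. -/
noncomputable def loopMoment (μ : Measure (unitaryGroup (Fin N) ℂ)) (b a n : ℕ) : ℂ :=
  ∫ U, completeSeq (-powerSum U) b * completeSeq (powerSum U) a * star (powerSum U n) ∂μ

lemma integrable_loopMoment (μ : Measure (unitaryGroup (Fin N) ℂ)) [IsProbabilityMeasure μ]
    (b a n : ℕ) : Integrable (fun U : unitaryGroup (Fin N) ℂ =>
      completeSeq (-powerSum U) b * completeSeq (powerSum U) a * star (powerSum U n)) μ :=
  integrable_of_continuous_unitaryGroup μ (by fun_prop)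

lemma sum_completeSeqDeriv_neg (p : ℕ → ℂ) (a b : ℕ) :
    ∑ x ∈ Finset.HasAntidiagonal.antidiagonal a,
      completeSeq p x.2 * completeSeqDeriv (-p) (fun m => -p (x.1 + m)) b =
    -(((a : ℂ) + b) * ∑ j ∈ Finset.range b, completeSeq (-p) j * completeSeq p (a + b - j)) := by
  cases b with
  | zero => simp [completeSeqDeriv]
  | succ b =>
    have h := sum_sum_completeSeq p a b
    push_cast
    rw [← add_assoc, ← add_assoc, ← h, ← Finset.sum_neg_distrib]
    refine Finset.sum_congr rfl fun x _ => ?_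
    simp only [completeSeqDeriv, smul_eq_mul, Finset.mul_sum]
    rw [← Finset.sum_neg_distrib]
    refine Finset.sum_congr rfl fun y _ => ?_
    rw [← add_assoc]; ring

lemma loop_equation (μ : Measure (unitaryGroup (Fin N) ℂ)) [IsProbabilityMeasure μ]
    [μ.IsMulLeftInvariant] (a b : ℕ) :
    (a : ℂ) * (a + N) * loopMoment μ b a (a + b) -
      ((a : ℂ) + b) * ∑ j ∈ Finset.range b, loopMoment μ j (a + b - j) (a + b) =
    ((a : ℂ) + b) * ∑ k ∈ Finset.range (a + 1), loopMoment μ b (a - k) (a + b - k) := by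
  have hp : ∀ k : ℕ, HasUnitaryGrad (fun U : unitaryGroup (Fin N) ℂ => powerSum U k)
      (fun U => (k : ℂ) • (U : Matrix (Fin N) (Fin N) ℂ) ^ k) := hasUnitaryGrad_trace_pow
  have hnp : ∀ k : ℕ, HasUnitaryGrad (fun U : unitaryGroup (Fin N) ℂ => (-powerSum U) k)
      (fun U => (k : ℂ) • -(U : Matrix (Fin N) (Fin N) ℂ) ^ k) := fun k X U => by
    simpa using (hp k X U).fun_neg
  have hgrad : ∀ i : ℕ, HasUnitaryGrad _ _ := fun i =>
    (hasUnitaryGrad_completeSeq hp i).mul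
      ((hasUnitaryGrad_completeSeq hnp b).mul (hp (a + b)).star_comp)
  have hcp : ∀ i, Continuous fun U : unitaryGroup (Fin N) ℂ =>
      completeSeqDeriv (powerSum U) (fun k => (U : Matrix (Fin N) (Fin N) ℂ) ^ k) i := fun i =>
    continuous_completeSeqDeriv continuous_powerSum (fun k => by fun_prop) i
  have hcnp : ∀ i, Continuous fun U : unitaryGroup (Fin N) ℂ =>
      completeSeqDeriv (-powerSum U) (fun k => -(U : Matrix (Fin N) (Fin N) ℂ) ^ k) i := fun i =>
    continuous_completeSeqDeriv (fun k => (continuous_powerSum k).neg) (fun k => by fun_prop) i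
  have hzero := fun x : ℕ × ℕ => (hgrad x.2).integral_loop μ (by fun_prop) (by fun_prop) x.1
  have htr : ∀ (U : unitaryGroup (Fin N) ℂ) (k i : ℕ), k ≤ a →
      trace ((U : Matrix (Fin N) (Fin N) ℂ) ^ k *
        ((completeSeq (-powerSum U) b * star (powerSum U (a + b))) •
          completeSeqDeriv (powerSum U) (fun k => (U : Matrix (Fin N) (Fin N) ℂ) ^ k) i +
        completeSeq (powerSum U) i • (star (powerSum U (a + b)) •
          completeSeqDeriv (-powerSum U) (fun k => -(U : Matrix (Fin N) (Fin N) ℂ) ^ k) b +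
          completeSeq (-powerSum U) b •
            -star (((a + b : ℕ) : ℂ) • (U : Matrix (Fin N) (Fin N) ℂ) ^ (a + b))))) =
      completeSeq (-powerSum U) b * star (powerSum U (a + b)) *
          completeSeqDeriv (powerSum U) (fun m => powerSum U (k + m)) i +
        star (powerSum U (a + b)) * (completeSeq (powerSum U) i *
          completeSeqDeriv (-powerSum U) (fun m => -powerSum U (k + m)) b) -
        ((a : ℂ) + b) * (completeSeq (-powerSum U) b * completeSeq (powerSum U) i *
          star (powerSum U (a + b - k))) := by
    intro U k i hk
    rw [mul_add, mul_smul_comm, mul_smul_comm, mul_add, mul_smul_comm, mul_smul_comm, mul_neg,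
      star_smul, mul_smul_comm, trace_add, trace_smul, trace_smul, trace_add, trace_smul,
      trace_smul, trace_neg, trace_smul, trace_pow_mul_star_pow U (by omega),
      trace_mul_completeSeqDeriv, trace_mul_completeSeqDeriv]
    simp only [smul_eq_mul, mul_neg, trace_neg, ← pow_add, Nat.cast_add, star_add, star_natCast]
    change _ = _ * completeSeqDeriv _ (fun m => trace _) i + _ *
      (_ * completeSeqDeriv _ (fun m => -trace _) b) - _
    ring
  have hpt : ∀ U : unitaryGroup (Fin N) ℂ, ∑ x ∈ Finset.HasAntidiagonal.antidiagonal a,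
      ((∑ m ∈ Finset.range x.1, powerSum U m * powerSum U (x.1 - m)) *
        (completeSeq (powerSum U) x.2 *
          (completeSeq (-powerSum U) b * star (powerSum U (a + b)))) +
      trace ((U : Matrix (Fin N) (Fin N) ℂ) ^ x.1 *
        ((completeSeq (-powerSum U) b * star (powerSum U (a + b))) •
          completeSeqDeriv (powerSum U) (fun k => (U : Matrix (Fin N) (Fin N) ℂ) ^ k) x.2 +
        completeSeq (powerSum U) x.2 • (star (powerSum U (a + b)) •
          completeSeqDeriv (-powerSum U) (fun k => -(U : Matrix (Fin N) (Fin N) ℂ) ^ k) b +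
          completeSeq (-powerSum U) b •
            -star (((a + b : ℕ) : ℂ) • (U : Matrix (Fin N) (Fin N) ℂ) ^ (a + b)))))) =
      (a : ℂ) * (a + N) * (completeSeq (-powerSum U) b * completeSeq (powerSum U) a *
        star (powerSum U (a + b))) -
      ((a : ℂ) + b) * (∑ j ∈ Finset.range b, completeSeq (-powerSum U) j *
        completeSeq (powerSum U) (a + b - j) * star (powerSum U (a + b))) -
      ((a : ℂ) + b) * ∑ k ∈ Finset.range (a + 1), completeSeq (-powerSum U) b *
        completeSeq (powerSum U) (a - k) * star (powerSum U (a + b - k)) := by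
    intro U
    have h1 := sum_completeSeq_loop (powerSum U) a
    have h2 := sum_completeSeqDeriv_neg (powerSum U) a b
    rw [powerSum_zero] at h1
    rw [← Finset.Nat.sum_antidiagonal_eq_sum_range_succ (fun k i => completeSeq (-powerSum U) b *
        completeSeq (powerSum U) i * star (powerSum U (a + b - k))), ← Finset.sum_mul]
    have e1 : ∀ s : ℂ, (a : ℂ) * (a + N) * (completeSeq (-powerSum U) b *
        completeSeq (powerSum U) a * s) = completeSeq (-powerSum U) b * s *
          ((a : ℂ) * (a + N) * completeSeq (powerSum U) a) := fun s => by ring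
    have e2 : ∀ S s : ℂ, ((a : ℂ) + b) * (S * s) = -(s * -(((a : ℂ) + b) * S)) :=
      fun S s => by ring
    rw [e1, e2, ← h1, ← h2, sub_neg_eq_add, Finset.mul_sum, Finset.mul_sum, Finset.mul_sum,
      ← Finset.sum_add_distrib, ← Finset.sum_sub_distrib]
    refine Finset.sum_congr rfl fun x hx => ?_
    rw [htr U x.1 x.2 (by have := Finset.HasAntidiagonal.mem_antidiagonal.1 hx; omega)]
    ring
  have hI := integral_congr_ae (μ := μ) (.of_forall hpt)
  rw [integral_finsetSum _ fun x _ => integrable_of_continuous_unitaryGroup μ (by fun_prop),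
    Finset.sum_eq_zero fun x _ => hzero x] at hI
  rw [integral_sub (integrable_of_continuous_unitaryGroup μ (by fun_prop))
      (integrable_of_continuous_unitaryGroup μ (by fun_prop)),
    integral_sub (integrable_of_continuous_unitaryGroup μ (by fun_prop))
      (integrable_of_continuous_unitaryGroup μ (by fun_prop)), integral_const_mul,
    integral_const_mul, integral_const_mul,
    integral_finsetSum _ fun x _ => integrable_loopMoment μ _ _ _,
    integral_finsetSum _ fun x _ => integrable_loopMoment μ _ _ _] at hI
  unfold loopMoment
  linear_combination -hI

end LoopEquation

section SecondMoment

open Matrix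

variable {N : ℕ}

lemma loopMoment_eq_zero_of_lt (μ : Measure (unitaryGroup (Fin N) ℂ)) {b : ℕ} (hb : N < b)
    (a n : ℕ) : loopMoment μ b a n = 0 := by
  have h : ∀ U : unitaryGroup (Fin N) ℂ, completeSeq (-powerSum U) b = 0 := fun U =>
    completeSeq_neg_trace_pow_eq_zero (U : Matrix (Fin N) (Fin N) ℂ) (by simpa using hb)
  simp [loopMoment, h]

lemma loopMoment_zero (μ : Measure (unitaryGroup (Fin N) ℂ)) [IsProbabilityMeasure μ] :
    loopMoment μ 0 0 0 = N := by
  simp [loopMoment]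

lemma sum_loopMoment (μ : Measure (unitaryGroup (Fin N) ℂ)) [IsProbabilityMeasure μ] (n : ℕ) :
    ∑ b ∈ Finset.range (n + 2), loopMoment μ b (n + 1 - b) (n + 1) = 0 := by
  unfold loopMoment
  rw [← integral_finsetSum _ fun b _ => integrable_loopMoment μ _ _ _]
  refine integral_eq_zero_of_ae (.of_forall fun U => ?_)
  have h := sum_completeSeq_neg_mul (powerSum U) n
  rw [Finset.Nat.sum_antidiagonal_eq_sum_range_succ (fun i j => completeSeq (-powerSum U) i *
    completeSeq (powerSum U) j)] at h
  simp [← Finset.sum_mul, h]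

lemma sum_mul_loopMoment (μ : Measure (unitaryGroup (Fin N) ℂ)) [IsProbabilityMeasure μ]
    {n : ℕ} (hn : n ≠ 0) :
    ∑ b ∈ Finset.range (n + 1), (b : ℂ) * loopMoment μ b (n - b) n =
      -∫ U, powerSum U n * star (powerSum U n) ∂μ := by
  simp only [loopMoment, ← integral_const_mul]
  rw [← integral_finsetSum _ fun b _ => (integrable_loopMoment μ _ _ _).const_mul _,
    ← integral_neg]
  refine integral_congr_ae (.of_forall fun U => ?_)
  have h := sum_mul_completeSeq_neg_mul (powerSum U) n
  rw [Finset.Nat.sum_antidiagonal_eq_sum_range_succ (fun i j => (i : ℂ) *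
    completeSeq (-powerSum U) i * completeSeq (powerSum U) j), if_neg hn] at h
  simp only [← mul_assoc, ← Finset.sum_mul, h]
  ring

lemma loopMoment_eq (μ : Measure (unitaryGroup (Fin N) ℂ)) [IsProbabilityMeasure μ]
    [μ.IsMulLeftInvariant] (hN : N ≠ 0) (n : ℕ) (hn : n ≠ 0) (b : ℕ) (hb : b ≤ n) :
    loopMoment μ b (n - b) n = if b = 0 then 1 else if b = min n N then -1 else 0 := by
  induction n using Nat.strong_induction_on generalizing b with
  | _ n ih =>
    have h0 : loopMoment μ 0 n n = 1 := by
      obtain ⟨m, rfl⟩ := Nat.exists_eq_succ_of_ne_zero hn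
      have h := loop_equation μ (m + 1) 0
      have h1 : ∀ k ∈ Finset.range m, loopMoment μ 0 (m + 1 - (k + 1)) (m + 1 - (k + 1)) = 1 := by
        intro k hk
        have := Finset.mem_range.1 hk
        simpa using ih (m + 1 - (k + 1)) (by omega) (by omega) 0 (by omega)
      rw [Finset.sum_range_succ, Finset.sum_range_succ'] at h
      simp only [add_zero, Finset.range_zero, Finset.sum_empty, mul_zero, sub_zero,
        Nat.cast_zero, Nat.sub_self, Nat.sub_zero, loopMoment_zero] at h
      rw [Finset.sum_congr rfl h1, Finset.sum_const, Finset.card_range, nsmul_eq_mul,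
        mul_one] at h
      have hm : (m : ℂ) + 1 ≠ 0 := by exact_mod_cast m.succ_ne_zero
      have hmN : (m : ℂ) + N ≠ 0 := by exact_mod_cast (by omega : m + N ≠ 0)
      push_cast at h
      have h2 := mul_left_cancel₀ hm ((mul_assoc _ _ _).symm.trans h)
      refine mul_left_cancel₀ hmN ?_
      linear_combination h2
    have hmid : ∀ b, b < min n N → loopMoment μ b (n - b) n = if b = 0 then 1 else 0 := by
      intro b
      induction b using Nat.strong_induction_on with
      | _ b ihb =>
        intro hb
        rcases Nat.eq_zero_or_pos b with rfl | hb0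
        · simpa using h0
        obtain ⟨hbn, hbN⟩ := lt_min_iff.1 hb
        obtain ⟨a, rfl⟩ : ∃ a, n = a + 1 + b := ⟨n - b - 1, by omega⟩
        have h := loop_equation μ (a + 1) b
        have h2 : ∀ k ∈ Finset.range a,
            loopMoment μ b (a + 1 - (k + 1)) (a + 1 + b - (k + 1)) = 0 := by
          intro k hk
          have := Finset.mem_range.1 hk
          have h1 := ih (a + 1 + b - (k + 1)) (by omega) (by omega) b (by omega)
          rwa [if_neg hb0.ne', if_neg (by omega),
            show a + 1 + b - (k + 1) - b = a + 1 - (k + 1) by omega] at h1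
        rw [Finset.sum_congr rfl fun j hj =>
            ihb j (Finset.mem_range.1 hj) ((Finset.mem_range.1 hj).trans hb),
          Finset.sum_ite_eq' (Finset.range b) 0, if_pos (Finset.mem_range.2 hb0),
          Finset.sum_range_succ, Finset.sum_range_succ', Finset.sum_eq_zero h2] at h
        have h1 := ih b (by omega) hb0.ne' b le_rfl
        rw [if_neg hb0.ne', if_pos (min_eq_left hbN.le).symm] at h1
        rw [Nat.sub_self] at h1
        rw [show a + 1 + b - (a + 1) = b by omega, Nat.sub_self, h1] at h
        rw [if_neg hb0.ne', Nat.add_sub_cancel]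
        simp only [Nat.sub_zero] at h
        have hne : ((a : ℂ) + 1) * (a + N) - b ≠ 0 := by
          have : b < (a + 1) * (a + N) := by nlinarith
          rw [sub_ne_zero]
          exact_mod_cast this.ne'
        refine (mul_eq_zero.1 ?_).resolve_left hne
        push_cast at h
        linear_combination h
    obtain rfl | hb0 := Nat.eq_zero_or_pos b
    · simpa using h0
    rw [if_neg hb0.ne']
    rcases lt_trichotomy b (min n N) with h | h | h
    · rw [hmid b h, if_neg hb0.ne', if_neg h.ne]
    · rw [if_pos h]
      obtain ⟨m, rfl⟩ := Nat.exists_eq_succ_of_ne_zero hn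
      have hs := sum_loopMoment μ m
      rw [← Finset.sum_subset (s₁ := {0, b}) (by
        intro x hx; simp at hx ⊢; omega) (by
        intro x hx hx'
        simp at hx hx'
        rcases lt_or_ge x b with hxb | hxb
        · rw [hmid x (h ▸ hxb), if_neg hx'.1]
        · exact loopMoment_eq_zero_of_lt μ (by omega) _ _),
        Finset.sum_pair hb0.ne, Nat.sub_zero, h0] at hs
      linear_combination hs
    · rw [if_neg h.ne', loopMoment_eq_zero_of_lt μ (by omega)]

/-- The Diaconis–Shahshahani second moment of the traces of powers. -/
lemma integral_powerSum_mul_star (μ : Measure (unitaryGroup (Fin N) ℂ)) [IsProbabilityMeasure μ]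
    [μ.IsMulLeftInvariant] (hN : N ≠ 0) {n : ℕ} (hn : n ≠ 0) :
    ∫ U, powerSum U n * star (powerSum U n) ∂μ = (min n N : ℕ) := by
  have h := sum_mul_loopMoment μ hn
  rw [Finset.sum_eq_single (min n N) (fun b hb hb' => by
      rw [loopMoment_eq μ hN n hn b (by have := Finset.mem_range.1 hb; omega), if_neg hb']
      split_ifs with h0 <;> simp [h0]) (fun h => absurd (Finset.mem_range.2 (by omega)) h),
    loopMoment_eq μ hN n hn _ (min_le_left _ _), if_neg (by omega), if_pos rfl] at h
  linear_combination h

end SecondMoment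

section Orthogonality

open Matrix

variable {N : ℕ}

/-- The traces `Tr (U ^ n)` for integer `n`. -/
noncomputable def intTrace (n : ℤ) (U : unitaryGroup (Fin N) ℂ) : ℂ :=
  trace ((U ^ n : unitaryGroup (Fin N) ℂ) : Matrix (Fin N) (Fin N) ℂ)

@[fun_prop]
lemma continuous_intTrace (n : ℤ) : Continuous (intTrace (N := N) n) := by
  have : Continuous fun U : unitaryGroup (Fin N) ℂ => U ^ n := continuous_zpow n
  unfold intTrace
  fun_prop

lemma intTrace_natCast (n : ℕ) (U : unitaryGroup (Fin N) ℂ) :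
    intTrace (n : ℤ) U = powerSum U n := by
  simp [intTrace, powerSum]

lemma intTrace_neg (n : ℤ) (U : unitaryGroup (Fin N) ℂ) :
    intTrace (-n) U = star (intTrace n U) := by
  rw [intTrace, intTrace, _root_.zpow_neg, ← Matrix.trace_conjTranspose]
  rfl

lemma norm_intTrace_le (n : ℤ) (U : unitaryGroup (Fin N) ℂ) : ‖intTrace n U‖ ≤ N := by
  refine (norm_sum_le _ _).trans ((Finset.sum_le_sum fun i _ =>
    entry_norm_bound_of_unitary (U ^ n).2 i i).trans ?_)
  simp

/-- The scalar matrices in the unitary group. -/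
noncomputable def scalarUnitary (N : ℕ) : unitary ℂ →* unitaryGroup (Fin N) ℂ where
  toFun z := ⟨algebraMap ℂ _ (z : ℂ), by
    rw [mem_unitaryGroup_iff, ← algebraMap_star_comm, ← map_mul, Unitary.mul_star_self_of_mem z.2,
      map_one]⟩
  map_one' := by ext1; simp
  map_mul' z w := by apply Subtype.ext; simp

lemma intTrace_scalar_mul (z : unitary ℂ) (n : ℤ) (U : unitaryGroup (Fin N) ℂ) :
    intTrace n (scalarUnitary N z * U) =
      ((z ^ n : unitary ℂ) : ℂ) * intTrace n U := by
  have hc : Commute (scalarUnitary N z) U := by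
    apply Subtype.ext
    exact Algebra.commutes (z : ℂ) (U : Matrix (Fin N) (Fin N) ℂ)
  rw [intTrace, hc.mul_zpow, ← map_zpow, intTrace,
    ← smul_eq_mul ((z ^ n : unitary ℂ) : ℂ), ← trace_smul]
  congr 1
  exact (Algebra.smul_def _ _).symm

lemma integral_intTrace_mul_of_add_ne_zero (μ : Measure (unitaryGroup (Fin N) ℂ))
    [μ.IsMulLeftInvariant] {n m : ℤ} (h : n + m ≠ 0) :
    ∫ U, intTrace n U * intTrace m U ∂μ = 0 := by
  let z : unitary ℂ := ⟨Complex.exp ((Real.pi / (n + m) : ℝ) * Complex.I), by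
    rw [Unitary.mem_iff_self_mul_star, Complex.star_def, ← Complex.exp_conj, ← Complex.exp_add]
    simp⟩
  have hz : ((z ^ n : unitary ℂ) : ℂ) * ((z ^ m : unitary ℂ) : ℂ) = -1 := by
    have h' : (n : ℂ) + m ≠ 0 := by exact_mod_cast h
    rw [← Submonoid.coe_mul, ← _root_.zpow_add, Unitary.coe_zpow, ← Complex.exp_int_mul,
      ← Complex.exp_pi_mul_I]
    congr 1
    push_cast
    field_simp
  have key := integral_mul_left_eq_self (μ := μ) (fun U => intTrace n U * intTrace m U)
    (scalarUnitary N z)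
  have e : ∀ U : unitaryGroup (Fin N) ℂ,
      intTrace n (scalarUnitary N z * U) *
      intTrace m (scalarUnitary N z * U) =
      -1 * (intTrace n U * intTrace m U) := fun U => by
    rw [intTrace_scalar_mul, intTrace_scalar_mul, ← hz]; ring
  simp only [e] at key
  rw [integral_const_mul] at key
  linear_combination (-1 / 2 : ℂ) * key

lemma integral_intTrace_mul_neg (μ : Measure (unitaryGroup (Fin N) ℂ)) [IsProbabilityMeasure μ]
    [μ.IsMulLeftInvariant] (hN : N ≠ 0) {n : ℤ} (hn : n ≠ 0) :
    ∫ U, intTrace n U * intTrace (-n) U ∂μ = (min n.natAbs N : ℕ) := by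
  have h := integral_powerSum_mul_star μ hN (Int.natAbs_ne_zero.2 hn)
  simp only [← intTrace_natCast, ← intTrace_neg] at h
  rcases Int.natAbs_eq n with hn' | hn'
  · rwa [← hn'] at h
  · rw [show ((n.natAbs : ℕ) : ℤ) = -n by omega] at h
    simpa [mul_comm] using h

lemma integral_sq_tsum_intTrace (μ : Measure (unitaryGroup (Fin N) ℂ)) [IsProbabilityMeasure μ]
    [μ.IsMulLeftInvariant] (hN : N ≠ 0) {c : ℤ → ℂ} (hc : Summable fun n => ‖c n‖)
    (h0 : c 0 = 0) :
    ∫ U, (∑' n, c n * intTrace n U) ^ 2 ∂μ =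
      ∑' n : ℤ, c n * c (-n) * (min n.natAbs N : ℕ) := by
  have hsum : ∀ U : unitaryGroup (Fin N) ℂ, Summable fun n => ‖c n * intTrace n U‖ := fun U =>
    (hc.mul_right (N : ℝ)).of_nonneg_of_le (fun _ => norm_nonneg _) fun n => by
      rw [norm_mul]; gcongr; exact norm_intTrace_le n U
  have hcc : Summable fun x : ℤ × ℤ => ‖c x.1‖ * ‖c x.2‖ * ((N : ℝ) * N) :=
    (hc.mul_of_nonneg hc (fun _ => norm_nonneg _) (fun _ => norm_nonneg _)).mul_right _
  let F : ℤ × ℤ → unitaryGroup (Fin N) ℂ → ℂ := fun x U =>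
    c x.1 * c x.2 * (intTrace x.1 U * intTrace x.2 U)
  have hF : ∀ x, Integrable (F x) μ := fun x =>
    integrable_of_continuous_unitaryGroup μ (by fun_prop)
  have hFb : ∀ x U, ‖F x U‖ ≤ ‖c x.1‖ * ‖c x.2‖ * ((N : ℝ) * N) := fun x U => by
    simp only [F, norm_mul]
    gcongr <;> exact norm_intTrace_le _ U
  have hFs : Summable fun x => ∫ U, ‖F x U‖ ∂μ :=
    hcc.of_nonneg_of_le (fun x => integral_nonneg fun U => norm_nonneg _) fun x => by
      simpa using integral_mono_of_nonneg (μ := μ) (.of_forall fun U => norm_nonneg (F x U))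
        (integrable_const (‖c x.1‖ * ‖c x.2‖ * ((N : ℝ) * N))) (.of_forall (hFb x))
  have hI := hasSum_integral_of_summable_integral_norm hF hFs
  have hsq : ∀ U, ∑' x, F x U = (∑' n, c n * intTrace n U) ^ 2 := fun U => by
    rw [sq, tsum_mul_tsum_of_summable_norm (hsum U) (hsum U)]
    exact tsum_congr fun x => by simp only [F]; ring
  simp only [hsq] at hI
  rw [← hI.tsum_eq, hI.summable.tsum_prod]
  refine tsum_congr fun n => ?_
  rw [tsum_eq_single (-n) fun m hm => ?_]
  · simp only [F, integral_const_mul]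
    rcases eq_or_ne n 0 with rfl | hn
    · simp [h0]
    · rw [integral_intTrace_mul_neg μ hN hn]
  · simp only [F, integral_const_mul]
    rw [integral_intTrace_mul_of_add_ne_zero μ (by omega), mul_zero]

end Orthogonality

section RiemannSum

lemma tendsto_riemannSum {g : ℝ → ℝ} (hg : Continuous g) {C : ℝ}
    (hC : ∀ u, |g u| ≤ C * (1 + u ^ 2)⁻¹) :
    Tendsto (fun N : ℕ => ∑' n : ℤ, (1 / N : ℝ) * g (n / N)) atTop (nhds (∫ u, g u)) := by
  have hC0 : 0 ≤ C := by simpa using (abs_nonneg _).trans (hC 0)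
  have hfl : ∀ N : ℕ, N ≠ 0 → ∀ u : ℝ, |(⌊N * u⌋ : ℝ) / N - u| ≤ 1 / N := fun N hN u => by
    have hN' : (0 : ℝ) < N := by exact_mod_cast Nat.pos_of_ne_zero hN
    rw [show (⌊N * u⌋ : ℝ) / N - u = (⌊N * u⌋ - N * u) / N by field_simp, abs_div,
      abs_of_pos hN']
    gcongr
    rw [abs_le]
    constructor <;> linarith [Int.floor_le (N * u), Int.lt_floor_add_one (N * u)]
  have hbound : ∀ N : ℕ, N ≠ 0 → ∀ u : ℝ,
      ‖g ((⌊N * u⌋ : ℝ) / N)‖ ≤ 3 * C * (1 + u ^ 2)⁻¹ := fun N hN u => by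
    set v := (⌊N * u⌋ : ℝ) / N
    have h1 : |v - u| ≤ 1 := (hfl N hN u).trans (by
      rw [div_le_one (by exact_mod_cast Nat.pos_of_ne_zero hN)]
      exact_mod_cast Nat.one_le_iff_ne_zero.2 hN)
    have h2 : 1 + u ^ 2 ≤ 3 * (1 + v ^ 2) := by
      obtain ⟨h3, h4⟩ := abs_le.1 h1
      nlinarith [sq_nonneg (2 * v - u), sq_nonneg (v + (v - u))]
    refine (hC v).trans ?_
    rw [mul_comm 3 C, mul_assoc]
    gcongr
    rw [← div_eq_mul_inv, inv_eq_one_div, div_le_div_iff₀ (by positivity) (by positivity)]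
    linarith
  have hmeas : ∀ N : ℕ, AEStronglyMeasurable (fun u : ℝ => g ((⌊N * u⌋ : ℝ) / N)) volume :=
    fun N => (hg.measurable.comp (by fun_prop)).aestronglyMeasurable
  have hbi : Integrable (fun u : ℝ => 3 * C * (1 + u ^ 2)⁻¹) :=
    integrable_inv_one_add_sq.const_mul _
  have hint : ∀ N : ℕ, N ≠ 0 → Integrable (fun u : ℝ => g ((⌊N * u⌋ : ℝ) / N)) := fun N hN =>
    hbi.mono' (hmeas N) (.of_forall (hbound N hN))
  have hlim : Tendsto (fun N : ℕ => ∫ u : ℝ, g ((⌊N * u⌋ : ℝ) / N)) atTop (nhds (∫ u, g u)) := by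
    refine tendsto_integral_filter_of_dominated_convergence _ (.of_forall hmeas)
      ((eventually_ne_atTop 0).mono fun N hN => .of_forall (hbound N hN)) hbi
      (.of_forall fun u => (hg.tendsto u).comp ?_)
    rw [tendsto_iff_dist_tendsto_zero]
    refine squeeze_zero' (.of_forall fun _ => dist_nonneg)
      ((eventually_ne_atTop 0).mono fun N hN => hfl N hN u) tendsto_one_div_atTop_nhds_zero_nat
  refine hlim.congr' ((eventually_ne_atTop 0).mono fun N hN => ?_)
  have hN' : (N : ℝ) ≠ 0 := by exact_mod_cast hN
  have hG : Integrable fun v : ℝ => g ((⌊v⌋ : ℝ) / N) :=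
    (integrable_comp_mul_left_iff (fun v : ℝ => g ((⌊v⌋ : ℝ) / N)) hN').1 (hint N hN)
  rw [Measure.integral_comp_mul_left (fun v : ℝ => g ((⌊v⌋ : ℝ) / N)),
    ← (hG.hasSum_intervalIntegral 0).tsum_eq]
  simp only
  rw [tsum_mul_left, smul_eq_mul, abs_of_nonneg (by positivity), one_div]
  congr 1
  refine tsum_congr fun n => ?_
  rw [zero_add, intervalIntegral.integral_of_le (by linarith), ← integral_Ico_eq_integral_Ioc,
    setIntegral_congr_fun measurableSet_Ico (g := fun _ => g (n / N)) fun v hv => by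
      simp only [Int.floor_eq_iff.2 hv]]
  simp

end RiemannSum

lemma fhat_neg {f fhat : ℝ → ℝ} (heven : ∀ x, f (-x) = f x)
    (hfourier : ∀ u : ℝ, (fhat u : ℂ) =
      ∫ x : ℝ, (f x : ℂ) * Complex.exp (-(2 * Real.pi * Complex.I) * x * u)) (u : ℝ) :
    fhat (-u) = fhat u := by
  have h : (fhat (-u) : ℂ) = fhat u := by
    rw [hfourier, hfourier, ← integral_neg_eq_self]
    refine integral_congr_ae (.of_forall fun x => ?_)
    simp [heven]
  exact_mod_cast h

lemma summable_of_rpow_decay {φ : ℝ → ℝ} {A δ : ℝ} (hA : 0 ≤ A) (hδ : 0 < δ)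
    (hdecay : ∀ u, |φ u| ≤ A * (1 + |u|) ^ (-(1 + δ))) {N : ℕ} (hN : N ≠ 0) :
    Summable fun n : ℤ => φ (n / N) := by
  have hN' : (0 : ℝ) < N := by exact_mod_cast Nat.pos_of_ne_zero hN
  refine Summable.of_norm_bounded_eventually
    ((Real.summable_abs_int_rpow (show 1 < 1 + δ by linarith)).mul_left
      (A * (N : ℝ) ^ (1 + δ))) ?_
  filter_upwards [(Set.finite_singleton (0 : ℤ)).compl_mem_cofinite] with n hn
  have hn' : (0 : ℝ) < |(n : ℝ)| := abs_pos.2 (by exact_mod_cast hn)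
  refine (hdecay _).trans ?_
  rw [mul_assoc]
  gcongr
  have h1 : (1 + |(n : ℝ) / N|) ^ (-(1 + δ)) ≤ (|(n : ℝ)| / N) ^ (-(1 + δ)) := by
    refine Real.rpow_le_rpow_of_nonpos (by positivity) ?_ (by linarith)
    rw [abs_div, abs_of_pos hN']
    linarith
  refine h1.trans (le_of_eq ?_)
  rw [Real.div_rpow hn'.le hN'.le, Real.rpow_neg hN'.le, div_inv_eq_mul, mul_comm]

lemma sq_le_of_rpow_decay {φ : ℝ → ℝ} {A δ : ℝ} (hA : 0 ≤ A) (hδ : 0 < δ)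
    (hdecay : ∀ u, |φ u| ≤ A * (1 + |u|) ^ (-(1 + δ))) (u : ℝ) :
    φ u ^ 2 ≤ A ^ 2 * (1 + u ^ 2)⁻¹ := by
  have h1 : (1 + |u|) ^ (-(1 + δ)) ≤ (1 + |u|)⁻¹ := by
    rw [← Real.rpow_neg_one]
    exact Real.rpow_le_rpow_of_exponent_le (by linarith [abs_nonneg u]) (by linarith)
  have h2 : |φ u| ≤ A * (1 + |u|)⁻¹ := (hdecay u).trans (by gcongr)
  rw [← sq_abs]
  calc |φ u| ^ 2 ≤ (A * (1 + |u|)⁻¹) ^ 2 := by gcongr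
    _ = A ^ 2 * ((1 + |u|) ^ 2)⁻¹ := by rw [mul_pow, inv_pow]
    _ ≤ A ^ 2 * (1 + u ^ 2)⁻¹ := by
      gcongr
      nlinarith [abs_nonneg u, sq_abs u]

lemma Zf_sub_fhat_zero {N : ℕ} (hN : N ≠ 0) {fhat : ℝ → ℝ}
    (hsum : Summable fun n : ℤ => fhat (n / N)) (U : Matrix.unitaryGroup (Fin N) ℂ) :
    Zf N fhat U - fhat 0 =
      ∑' n : ℤ, (if n = 0 then 0 else (1 / N : ℂ) * fhat (n / N)) * intTrace n U := by
  have hs : Summable fun n : ℤ => (1 / N : ℂ) * fhat (n / N) * intTrace n U := by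
    refine ((hsum.abs.mul_left (1 / N : ℝ)).mul_right (N : ℝ)).of_norm_bounded fun n => ?_
    simp only [norm_mul, norm_div, norm_one, Complex.norm_natCast, Complex.norm_real,
      Real.norm_eq_abs]
    gcongr
    exact norm_intTrace_le n U
  have h := hs.tsum_eq_add_tsum_ite 0
  have h0 : intTrace 0 U = N := by simpa using intTrace_natCast 0 U
  have hN' : (N : ℂ) ≠ 0 := by exact_mod_cast hN
  rw [h0] at h
  rw [Zf]
  refine sub_eq_of_eq_add' (h.trans ?_)
  congr 1
  · simp [field]
  · refine tsum_congr fun n => ?_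
    split_ifs <;> simp

lemma integral_sq_Zf_sub {N : ℕ} (hN : N ≠ 0) (μ : Measure (Matrix.unitaryGroup (Fin N) ℂ))
    [IsProbabilityMeasure μ] [μ.IsMulLeftInvariant] {fhat : ℝ → ℝ}
    (hneg : ∀ u, fhat (-u) = fhat u) (hsum : Summable fun n : ℤ => fhat (n / N)) :
    ∫ U, (Zf N fhat U - (fhat 0 : ℂ)) ^ 2 ∂μ =
      ((∑' n : ℤ, (1 / N : ℝ) * (min 1 |(n / N : ℝ)| * fhat (n / N) ^ 2) : ℝ) : ℂ) := by
  have hN' : (0 : ℝ) < N := by exact_mod_cast Nat.pos_of_ne_zero hN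
  simp only [Zf_sub_fhat_zero hN hsum]
  rw [integral_sq_tsum_intTrace μ hN ?_ (if_pos rfl), Complex.ofReal_tsum]
  · refine tsum_congr fun n => ?_
    rcases eq_or_ne n 0 with rfl | hn
    · simp
    have hmin : ((min n.natAbs N : ℕ) : ℝ) = N * min 1 |(n / N : ℝ)| := by
      rw [Nat.cast_min, Nat.cast_natAbs, abs_div, abs_of_pos hN', mul_min_of_nonneg _ _ hN'.le,
        mul_one, mul_div_cancel₀ _ hN'.ne', min_comm, Int.cast_abs]
    rw [if_neg hn, if_neg (neg_ne_zero.2 hn), Int.cast_neg, neg_div, hneg,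
      ← Complex.ofReal_natCast (min n.natAbs N), hmin]
    have hN'' : (N : ℂ) ≠ 0 := by exact_mod_cast hN
    push_cast
    field_simp
  · refine (hsum.abs.mul_left (1 / N : ℝ)).of_nonneg_of_le (fun _ => norm_nonneg _) fun n => ?_
    split_ifs
    · simpa using by positivity
    · simp

/-- The variance of `Z_f` over `U(N)` with Haar probability measure converges, as `N → ∞`,
to `∫ min(1,|u|) f̂(u)² du`. -/
theorem variance_Zf_tendsto
    (μ : ∀ N : ℕ, Measure (Matrix.unitaryGroup (Fin N) ℂ))
    (hprob : ∀ N, IsProbabilityMeasure (μ N))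
    (hinv : ∀ N, (μ N).IsMulLeftInvariant)
    (f fhat : ℝ → ℝ) (heven : ∀ x, f (-x) = f x) (hint : MeasureTheory.Integrable f)
    (hcont : Continuous fhat)
    (hdecay : ∃ A δ : ℝ, 0 < A ∧ 0 < δ ∧ ∀ u : ℝ, |fhat u| ≤ A * (1 + |u|) ^ (-(1 + δ)))
    (hfourier : ∀ u : ℝ, (fhat u : ℂ) =
      ∫ x : ℝ, (f x : ℂ) * Complex.exp (-(2 * Real.pi * Complex.I) * x * u)) :
    Tendsto (fun N : ℕ => ∫ U, (Zf N fhat U - (fhat 0 : ℂ)) ^ 2 ∂(μ N))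
      atTop
      (nhds ((∫ u : ℝ, min 1 |u| * fhat u ^ 2 : ℝ) : ℂ)) := by
  obtain ⟨A, δ, hA, hδ, hdecay⟩ := hdecay
  have hg : Continuous fun u : ℝ => min 1 |u| * fhat u ^ 2 := by fun_prop
  have hb : ∀ u : ℝ, |min 1 |u| * fhat u ^ 2| ≤ A ^ 2 * (1 + u ^ 2)⁻¹ := fun u => by
    have h0 : 0 ≤ min 1 |u| := le_min zero_le_one (abs_nonneg u)
    rw [abs_of_nonneg (mul_nonneg h0 (sq_nonneg _))]
    exact (mul_le_of_le_one_left (sq_nonneg _) (min_le_left _ _)).trans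
      (sq_le_of_rpow_decay hA.le hδ hdecay u)
  refine ((Complex.continuous_ofReal.tendsto _).comp (tendsto_riemannSum hg hb)).congr'
    ((eventually_ne_atTop 0).mono fun N hN => ?_)
  have := hprob N
  have := hinv N
  exact (integral_sq_Zf_sub hN (μ N) (fhat_neg heven hfourier)
    (summable_of_rpow_decay hA.le hδ hdecay hN)).symm
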